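/- (MBRL performance bound) Let M = (S, A, μ, p, r) be the true MDP and M̂ = (S, A, μ, p̂, r) the model MDP, where p̂ is trained on data collected by a policy π_D. For any policy π, if E_{(s,a)∼d^{π_D}}[D_TV(p(·|s,a), p̂(·|s,a))] ≤ ε_m and E_{s∼d^{π_D}}[D_TV(π(·|s), π_D(·|s))] ≤ ε_π, then |J_M(π) − J_{M̂}(π)| ≤ (R/(1−γ)²)(4 ε_π + 2γ ε_m). -/

import Mathlib

open scoped BigOperators

/-- Probability of being in each state at time `t` under initial distribution `μ`,
dynamics `p`, and policy `π`. -/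
noncomputable def stateProb {S A : Type*} [Fintype S] [Fintype A]
    (μ : S → ℝ) (p : S → A → S → ℝ) (π : S → A → ℝ) : ℕ → S → ℝ
  | 0 => μ
  | t + 1 => fun s => ∑ s₀ : S, ∑ a₀ : A, stateProb μ p π t s₀ * π s₀ a₀ * p s₀ a₀ s

/-- Discounted state distribution `d^π(s) = (1-γ) ∑_{t≥0} γ^t P(s_t = s)`. -/
noncomputable def dState {S A : Type*} [Fintype S] [Fintype A]
    (γ : ℝ) (μ : S → ℝ) (p : S → A → S → ℝ) (π : S → A → ℝ) (s : S) : ℝ :=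
  (1 - γ) * ∑' t : ℕ, γ ^ t * stateProb μ p π t s

/-- Discounted state-action distribution `d^π(s,a) = π(a|s) d^π(s)`. -/
noncomputable def dSA {S A : Type*} [Fintype S] [Fintype A]
    (γ : ℝ) (μ : S → ℝ) (p : S → A → S → ℝ) (π : S → A → ℝ) (s : S) (a : A) : ℝ :=
  π s a * dState γ μ p π s

/-- Total variation distance between distributions on a finite set. -/
noncomputable def DTV {X : Type*} [Fintype X] (p q : X → ℝ) : ℝ :=
  (1 / 2) * ∑ x, |p x - q x|

/-- Expected discounted return `J_M(π) = (1/(1-γ)) E_{(s,a)∼d^π}[r(s,a)]`. -/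
noncomputable def J {S A : Type*} [Fintype S] [Fintype A]
    (γ : ℝ) (μ : S → ℝ) (p : S → A → S → ℝ) (π : S → A → ℝ) (r : S → A → ℝ) : ℝ :=
  (1 / (1 - γ)) * ∑ s, ∑ a, dSA γ μ p π s a * r s a

/-- A probability distribution on a finite set. -/
def IsProb {X : Type*} [Fintype X] (p : X → ℝ) : Prop :=
  (∀ x, 0 ≤ p x) ∧ ∑ x, p x = 1

lemma stateProb_isProb {S A : Type*} [Fintype S] [Fintype A]
    (μ : S → ℝ) (hμ : IsProb μ) (p : S → A → S → ℝ) (hp : ∀ s a, IsProb (p s a))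
    (π : S → A → ℝ) (hπ : ∀ s, IsProb (π s)) (t : ℕ) : IsProb (stateProb μ p π t) := by
  induction t with
  | zero => exact hμ
  | succ t ih =>
    constructor
    · intro s
      exact Finset.sum_nonneg fun s₀ _ => Finset.sum_nonneg fun a₀ _ =>
        mul_nonneg (mul_nonneg (ih.1 s₀) ((hπ s₀).1 a₀)) ((hp s₀ a₀).1 s)
    · change ∑ s, ∑ s₀ : S, ∑ a₀ : A, stateProb μ p π t s₀ * π s₀ a₀ * p s₀ a₀ s = 1
      rw [Finset.sum_comm]
      rw [← ih.2]
      refine Finset.sum_congr rfl fun s₀ _ => ?_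
      rw [Finset.sum_comm]
      simp_rw [← Finset.mul_sum, (hp _ _).2, mul_one, ← Finset.mul_sum, (hπ _).2, mul_one]

lemma stateProb_summable {S A : Type*} [Fintype S] [Fintype A]
    (γ : ℝ) (hγ0 : 0 ≤ γ) (hγ1 : γ < 1)
    (μ : S → ℝ) (hμ : IsProb μ) (p : S → A → S → ℝ) (hp : ∀ s a, IsProb (p s a))
    (π : S → A → ℝ) (hπ : ∀ s, IsProb (π s)) (s : S) :
    Summable fun t : ℕ => γ ^ t * stateProb μ p π t s := by
  refine Summable.of_nonneg_of_le (fun t => ?_) (fun t => ?_)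
    (summable_geometric_of_lt_one hγ0 hγ1)
  · exact mul_nonneg (pow_nonneg hγ0 t) ((stateProb_isProb μ hμ p hp π hπ t).1 s)
  · have h := stateProb_isProb μ hμ p hp π hπ t
    have h1 : stateProb μ p π t s ≤ 1 := by
      rw [← h.2]
      exact Finset.single_le_sum (fun i _ => h.1 i) (Finset.mem_univ s)
    exact mul_le_of_le_one_right (pow_nonneg hγ0 t) h1

lemma dState_nonneg {S A : Type*} [Fintype S] [Fintype A]
    (γ : ℝ) (hγ0 : 0 ≤ γ) (hγ1 : γ < 1)
    (μ : S → ℝ) (hμ : IsProb μ) (p : S → A → S → ℝ) (hp : ∀ s a, IsProb (p s a))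
    (π : S → A → ℝ) (hπ : ∀ s, IsProb (π s)) (s : S) : 0 ≤ dState γ μ p π s :=
  mul_nonneg (by linarith) (tsum_nonneg fun t =>
    mul_nonneg (pow_nonneg hγ0 t) ((stateProb_isProb μ hμ p hp π hπ t).1 s))

lemma dState_eq {S A : Type*} [Fintype S] [Fintype A]
    (γ : ℝ) (hγ0 : 0 ≤ γ) (hγ1 : γ < 1)
    (μ : S → ℝ) (hμ : IsProb μ) (p : S → A → S → ℝ) (hp : ∀ s a, IsProb (p s a))
    (π : S → A → ℝ) (hπ : ∀ s, IsProb (π s)) (s : S) :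
    dState γ μ p π s = (1 - γ) * μ s +
      γ * ∑ s₀, ∑ a₀, dState γ μ p π s₀ * (π s₀ a₀ * p s₀ a₀ s) := by
  have hs := stateProb_summable γ hγ0 hγ1 μ hμ p hp π hπ
  have key : HasSum (fun t : ℕ => γ ^ (t + 1) * stateProb μ p π (t + 1) s)
      (γ * ∑ s₀, ∑ a₀, (∑' t : ℕ, γ ^ t * stateProb μ p π t s₀) * (π s₀ a₀ * p s₀ a₀ s)) := by
    have h := (hasSum_sum (s := Finset.univ) fun s₀ _ => hasSum_sum (s := Finset.univ)
      fun a₀ _ => (hs s₀).hasSum.mul_right (π s₀ a₀ * p s₀ a₀ s)).mul_left γ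
    refine h.congr_fun ?_
    intro t
    simp only [stateProb, Finset.mul_sum]
    refine Finset.sum_congr rfl fun s₀ _ => Finset.sum_congr rfl fun a₀ _ => ?_
    ring
  unfold dState
  rw [(hs s).tsum_eq_zero_add, key.tsum_eq]
  simp only [pow_zero, one_mul, stateProb, mul_add, mul_assoc, ← Finset.mul_sum]
  ring

lemma DTV_two {X : Type*} [Fintype X] (p q : X → ℝ) : ∑ x, |p x - q x| = 2 * DTV p q := by
  unfold DTV; ring

lemma J_diff_bound {S A : Type*} [Fintype S] [Fintype A]
    (γ : ℝ) (hγ0 : 0 ≤ γ) (hγ1 : γ < 1)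
    (μ : S → ℝ) (hμ : IsProb μ)
    (p p' : S → A → S → ℝ) (hp : ∀ s a, IsProb (p s a)) (hp' : ∀ s a, IsProb (p' s a))
    (π πD : S → A → ℝ) (hπ : ∀ s, IsProb (π s)) (hπD : ∀ s, IsProb (πD s))
    (r : S → A → ℝ) (R : ℝ) (hR : 0 ≤ R) (hr : ∀ s a, |r s a| ≤ R)
    (εm επ : ℝ)
    (hm : ∑ s : S, ∑ a : A, dSA γ μ p πD s a * DTV (p s a) (p' s a) ≤ εm)
    (hπdiff : ∑ s : S, dState γ μ p πD s * DTV (π s) (πD s) ≤ επ) :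
    |J γ μ p πD r - J γ μ p' π r| ≤ R / (1 - γ) ^ 2 * (2 * επ + 2 * γ * εm) := by
  have hg : 0 < 1 - γ := by linarith
  have hd := dState_nonneg γ hγ0 hγ1 μ hμ p hp πD hπD
  have hdeq := dState_eq γ hγ0 hγ1 μ hμ p hp πD hπD
  have hdeq' := dState_eq γ hγ0 hγ1 μ hμ p' hp' π hπ
  unfold dSA at hm
  unfold J dSA
  generalize dState γ μ p πD = d at *
  generalize dState γ μ p' π = d' at *
  have hX : ∑ s, ∑ a, d s * |π s a - πD s a| ≤ 2 * επ := by
    simp_rw [← Finset.mul_sum, DTV_two]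
    calc ∑ s, d s * (2 * DTV (π s) (πD s)) = 2 * ∑ s, d s * DTV (π s) (πD s) := by
          rw [Finset.mul_sum]; exact Finset.sum_congr rfl fun s _ => by ring
      _ ≤ _ := by linarith
  have hY : ∑ s, ∑ a, d s * (πD s a * ∑ x, |p s a x - p' s a x|) ≤ 2 * εm := by
    simp_rw [DTV_two]
    calc _ = 2 * ∑ s, ∑ a, πD s a * d s * DTV (p s a) (p' s a) := by
          simp_rw [Finset.mul_sum]
          exact Finset.sum_congr rfl fun s _ => Finset.sum_congr rfl fun a _ => by ring
      _ ≤ _ := by linarith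
  have hpt : ∀ s, |d' s - d s| ≤ γ * ∑ s₀, ∑ a₀, (|d' s₀ - d s₀| * (π s₀ a₀ * p' s₀ a₀ s)
      + d s₀ * |π s₀ a₀ - πD s₀ a₀| * p' s₀ a₀ s
      + d s₀ * (πD s₀ a₀ * |p s₀ a₀ s - p' s₀ a₀ s|)) := by
    intro s
    have e : d' s - d s = γ * ∑ s₀, ∑ a₀, (d' s₀ * (π s₀ a₀ * p' s₀ a₀ s)
        - d s₀ * (πD s₀ a₀ * p s₀ a₀ s)) := by
      rw [hdeq' s, hdeq s]
      simp_rw [Finset.sum_sub_distrib]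
      ring
    rw [e, abs_mul, abs_of_nonneg hγ0]
    refine mul_le_mul_of_nonneg_left ?_ hγ0
    refine (Finset.abs_sum_le_sum_abs _ _).trans (Finset.sum_le_sum fun s₀ _ => ?_)
    refine (Finset.abs_sum_le_sum_abs _ _).trans (Finset.sum_le_sum fun a₀ _ => ?_)
    have e2 : d' s₀ * (π s₀ a₀ * p' s₀ a₀ s) - d s₀ * (πD s₀ a₀ * p s₀ a₀ s)
        = (d' s₀ - d s₀) * (π s₀ a₀ * p' s₀ a₀ s)
          + d s₀ * (π s₀ a₀ - πD s₀ a₀) * p' s₀ a₀ s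
          + d s₀ * (πD s₀ a₀ * (p' s₀ a₀ s - p s₀ a₀ s)) := by ring
    rw [e2]
    refine (abs_add_three _ _ _).trans (le_of_eq ?_)
    simp only [abs_mul, abs_of_nonneg (hd s₀), abs_of_nonneg ((hπ s₀).1 a₀),
      abs_of_nonneg ((hπD s₀).1 a₀), abs_of_nonneg ((hp' s₀ a₀).1 s),
      abs_sub_comm (p' s₀ a₀ s)]
  have hD : ∑ s, |d' s - d s| ≤ γ * (∑ s, |d' s - d s| + 2 * επ + 2 * εm) := by
    calc ∑ s, |d' s - d s| ≤ _ := Finset.sum_le_sum fun s _ => hpt s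
      _ = γ * (∑ s, |d' s - d s| + ∑ s, ∑ a, d s * |π s a - πD s a|
          + ∑ s, ∑ a, d s * (πD s a * ∑ x, |p s a x - p' s a x|)) := by
          rw [← Finset.mul_sum, Finset.sum_comm]
          congr 1
          rw [← Finset.sum_add_distrib, ← Finset.sum_add_distrib]
          refine Finset.sum_congr rfl fun s₀ _ => ?_
          rw [Finset.sum_comm]
          simp_rw [Finset.sum_add_distrib, ← Finset.mul_sum, (hp' _ _).2, mul_one, (hπ _).2,
            mul_one, ← Finset.mul_sum]
      _ ≤ _ := mul_le_mul_of_nonneg_left (by linarith) hγ0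
  have hJ : |∑ s, ∑ a, πD s a * d s * r s a - ∑ s, ∑ a, π s a * d' s * r s a|
      ≤ R * (∑ s, |d' s - d s| + 2 * επ) := by
    calc _ ≤ ∑ s, ∑ a, R * (|d' s - d s| * π s a + d s * |π s a - πD s a|) := by
          simp_rw [← Finset.sum_sub_distrib]
          refine (Finset.abs_sum_le_sum_abs _ _).trans (Finset.sum_le_sum fun s _ => ?_)
          refine (Finset.abs_sum_le_sum_abs _ _).trans (Finset.sum_le_sum fun a _ => ?_)
          have e : πD s a * d s * r s a - π s a * d' s * r s a
            = -(r s a * ((d' s - d s) * π s a + d s * (π s a - πD s a))) := by ring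
          rw [e, abs_neg, abs_mul]
          refine mul_le_mul (hr s a) ?_ (abs_nonneg _) hR
          refine (abs_add_le _ _).trans (le_of_eq ?_)
          simp only [abs_mul, abs_of_nonneg (hd s), abs_of_nonneg ((hπ s).1 a)]
      _ = R * (∑ s, |d' s - d s| + ∑ s, ∑ a, d s * |π s a - πD s a|) := by
          simp_rw [← Finset.mul_sum, Finset.sum_add_distrib, ← Finset.mul_sum, (hπ _).2, mul_one]
      _ ≤ _ := mul_le_mul_of_nonneg_left (by linarith) hR
  have hD2 : ∑ s, |d' s - d s| + 2 * επ ≤ (2 * επ + 2 * γ * εm) / (1 - γ) := by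
    rw [le_div_iff₀ hg]
    nlinarith
  rw [← mul_sub, abs_mul, abs_of_pos (by positivity : 0 < 1 / (1 - γ))]
  calc _ ≤ 1 / (1 - γ) * (R * ((2 * επ + 2 * γ * εm) / (1 - γ))) :=
        mul_le_mul_of_nonneg_left (hJ.trans (mul_le_mul_of_nonneg_left hD2 hR)) (by positivity)
    _ = _ := by field_simp

/-- MBRL performance bound: difference between the return of `π` in the true MDP
(dynamics `p`) and in the model MDP (dynamics `p̂` trained on data from `πD`). -/
theorem mbrl_performance_bound {S A : Type*} [Fintype S] [Fintype A]
    (γ : ℝ) (hγ0 : 0 ≤ γ) (hγ1 : γ < 1)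
    (μ : S → ℝ) (hμ : IsProb μ)
    (p phat : S → A → S → ℝ) (hp : ∀ s a, IsProb (p s a)) (hphat : ∀ s a, IsProb (phat s a))
    (π πD : S → A → ℝ) (hπ : ∀ s, IsProb (π s)) (hπD : ∀ s, IsProb (πD s))
    (r : S → A → ℝ) (R : ℝ) (hr : ∀ s a, |r s a| ≤ R)
    (εm επ : ℝ)
    (hm : ∑ s : S, ∑ a : A, dSA γ μ p πD s a * DTV (p s a) (phat s a) ≤ εm)
    (hπdiff : ∑ s : S, dState γ μ p πD s * DTV (π s) (πD s) ≤ επ) :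
    |J γ μ p π r - J γ μ phat π r| ≤
      R / (1 - γ) ^ 2 * (4 * επ + 2 * γ * εm) := by
  have hR : 0 ≤ R := by
    have hS : Nonempty S := by
      by_contra h
      rw [not_nonempty_iff] at h
      have := hμ.2
      simp at this
    obtain ⟨s⟩ := hS
    have hA : Nonempty A := by
      by_contra h
      rw [not_nonempty_iff] at h
      have := (hπ s).2
      simp at this
    obtain ⟨a⟩ := hA
    exact (abs_nonneg _).trans (hr s a)
  have h1 := J_diff_bound γ hγ0 hγ1 μ hμ p phat hp hphat π πD hπ hπD r R hR hr εm επ hm hπdiff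
  have h2 := J_diff_bound γ hγ0 hγ1 μ hμ p p hp hp π πD hπ hπD r R hR hr 0 επ
    (by simp [DTV]) hπdiff
  have h3 := abs_sub_le (J γ μ p π r) (J γ μ p πD r) (J γ μ phat π r)
  rw [abs_sub_comm (J γ μ p π r) (J γ μ p πD r)] at h3
  linarith
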